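/- arXiv:2012.07375 — 3 statements merged into one kernel-verified Lean document; each statement's English description precedes it below -/
import Mathlib

section
/- For every integer k ≥ 2, the broom B_{2k} = B_{k(2k+1),2k} satisfies lb_W(B_{2k}) − lb(B_{2k}) = 4k(k−1)², which is strictly positive; that is, the weight-center-based lower bound for the hamiltonian chromatic number is strictly larger than the center-based lower bound. -/
open SimpleGraph Finset

namespace HCPaper

variable {V : Type*}

/-- The detour distance `D(u,v)`: the length of a longest `u`–`v` path. -/
noncomputable def detourDist (G : SimpleGraph V) (u v : V) : ℕ :=
  sSup {n | ∃ p : G.Walk u v, p.IsPath ∧ p.length = n}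

/-- A hamiltonian coloring: `D(u,v) + |h u - h v| ≥ n - 1` for all distinct `u, v`. -/
def IsHamiltonianColoring [Fintype V] (G : SimpleGraph V) (h : V → ℕ) : Prop :=
  ∀ u v : V, u ≠ v →
    Fintype.card V - 1 ≤ detourDist G u v + Nat.dist (h u) (h v)

/-- The span of a coloring: the maximum of `|h u - h v|`. -/
noncomputable def spanOf (h : V → ℕ) : ℕ :=
  sSup (Set.range fun p : V × V => Nat.dist (h p.1) (h p.2))

/-- The hamiltonian chromatic number: minimum span over hamiltonian colorings. -/
noncomputable def hc [Fintype V] (G : SimpleGraph V) : ℕ :=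
  sInf {s | ∃ h : V → ℕ, IsHamiltonianColoring G h ∧ spanOf h = s}

/-- The weight of the graph from a vertex `v`. -/
noncomputable def treeWeight [Fintype V] (G : SimpleGraph V) (v : V) : ℕ :=
  ∑ u, G.dist u v

/-- The set of weight centers. -/
def WeightCenters [Fintype V] (G : SimpleGraph V) : Set V :=
  {v | ∀ u, treeWeight G v ≤ treeWeight G u}

/-- The detour level `L(u) = min {d(u,w) : w ∈ W(T)}`. -/
noncomputable def detourLevel [Fintype V] (G : SimpleGraph V) (u : V) : ℕ :=
  sInf {k | ∃ w ∈ WeightCenters G, G.dist u w = k}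

/-- The total detour level `L_W(T) = ∑ L(u)`. -/
noncomputable def totalDetourLevel [Fintype V] (G : SimpleGraph V) : ℕ :=
  ∑ u, detourLevel G u

/-- `ζ(T)` : 0 if one weight center, 1 if two. -/
noncomputable def zeta [Fintype V] (G : SimpleGraph V) : ℕ :=
  if (WeightCenters G).ncard = 2 then 1 else 0

/-- `ζ'(T) = 1 - ζ(T)`. -/
noncomputable def zeta' [Fintype V] (G : SimpleGraph V) : ℕ := 1 - zeta G

/-- `t` is an ancestor of `v` : `t` lies on the path joining the nearest weight center and `v`. -/
def IsAncestor [Fintype V] (G : SimpleGraph V) (t v : V) : Prop :=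
  ∃ w ∈ WeightCenters G, G.dist v w = detourLevel G v ∧
    ∃ p : G.Walk w v, p.IsPath ∧ t ∈ p.support

/-- `φ(u,v)`: maximum detour level of a common ancestor of `u` and `v`. -/
noncomputable def phi [Fintype V] (G : SimpleGraph V) (u v : V) : ℕ :=
  sSup {k | ∃ t, IsAncestor G t u ∧ IsAncestor G t v ∧ detourLevel G t = k}

open Classical in
/-- `δ(u,v)`: 1 if there are two weight centers `w, w'` and the `u`–`v` path contains
the edge `ww'`, 0 otherwise. -/
noncomputable def delta [Fintype V] (G : SimpleGraph V) (u v : V) : ℕ :=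
  if ∃ w w', w ≠ w' ∧ WeightCenters G = {w, w'} ∧
      ∃ p : G.Walk u v, p.IsPath ∧ s(w, w') ∈ p.edges
  then 1 else 0

/-- `u` and `v` lie in different branches: branches at two distinct vertices adjacent to
the same weight center. -/
def InDifferentBranches [Fintype V] (G : SimpleGraph V) (u v : V) : Prop :=
  ∃ w b₁ b₂, w ∈ WeightCenters G ∧ b₁ ≠ b₂ ∧
    b₁ ∉ WeightCenters G ∧ b₂ ∉ WeightCenters G ∧
    G.Adj w b₁ ∧ G.Adj w b₂ ∧ IsAncestor G b₁ u ∧ IsAncestor G b₂ v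

/-- `u` and `v` lie in opposite branches: branches at vertices adjacent to different
weight centers. -/
def InOppositeBranches [Fintype V] (G : SimpleGraph V) (u v : V) : Prop :=
  ∃ w₁ w₂ b₁ b₂, w₁ ∈ WeightCenters G ∧ w₂ ∈ WeightCenters G ∧ w₁ ≠ w₂ ∧
    b₁ ∉ WeightCenters G ∧ b₂ ∉ WeightCenters G ∧
    G.Adj w₁ b₁ ∧ G.Adj w₂ b₂ ∧ IsAncestor G b₁ u ∧ IsAncestor G b₂ v

/-- The eccentricity of a vertex. -/
noncomputable def ecc (G : SimpleGraph V) (v : V) : ℕ :=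
  sSup (Set.range fun u => G.dist v u)

/-- The center of a graph: vertices of minimum eccentricity. -/
def graphCenter (G : SimpleGraph V) : Set V :=
  {v | ∀ u, ecc G v ≤ ecc G u}

/-- The total level with respect to the center `C(T)`. -/
noncomputable def totalLevel [Fintype V] (G : SimpleGraph V) : ℕ :=
  ∑ u, sInf {k | ∃ x ∈ graphCenter G, G.dist u x = k}

/-- `ε(T)` : 0 if the center has one vertex, 1 if two. -/
noncomputable def eps [Fintype V] (G : SimpleGraph V) : ℕ :=
  if (graphCenter G).ncard = 2 then 1 else 0

/-- `ε'(T) = 1 - ε(T)`. -/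
noncomputable def eps' [Fintype V] (G : SimpleGraph V) : ℕ := 1 - eps G

/-- The weight-center based lower bound `lb_W(T)`. -/
noncomputable def lbW [Fintype V] (G : SimpleGraph V) : ℤ :=
  ((Fintype.card V : ℤ) - 1) * ((Fintype.card V : ℤ) - 1 - zeta G) +
    zeta' G - 2 * totalDetourLevel G

/-- The center based lower bound `lb(T)`. -/
noncomputable def lbC [Fintype V] (G : SimpleGraph V) : ℤ :=
  ((Fintype.card V : ℤ) - 1) * ((Fintype.card V : ℤ) - 1 - eps G) +
    eps' G - 2 * totalLevel G

/-- The broom `B_{n,d}`: a path on vertices `0, …, d-1` together with `n - d` pendant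
vertices all adjacent to the end vertex `d-1` of the path. -/
def broom (n d : ℕ) : SimpleGraph (Fin n) :=
  SimpleGraph.fromRel (fun i j =>
    (i.val + 1 = j.val ∧ j.val < d) ∨ (i.val + 1 = d ∧ d ≤ j.val))

/-- The star `K_{1,n-1}`: vertex `0` adjacent to the `n - 1` other vertices. -/
def starGraph (n : ℕ) : SimpleGraph (Fin n) :=
  SimpleGraph.fromRel (fun i _ => i.val = 0)

/-- The caterpillar `C(m,d)`: a spine `v_1, …, v_m` with `d - 2` legs attached to each
inner spine vertex `v_2, …, v_{m-1}` (so each inner spine vertex has degree `d`). -/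
def caterpillar (m d : ℕ) : SimpleGraph (Fin m ⊕ Fin (m - 2) × Fin (d - 2)) :=
  SimpleGraph.fromRel (fun x y =>
    (∃ i j : Fin m, x = Sum.inl i ∧ y = Sum.inl j ∧ i.val + 1 = j.val) ∨
    (∃ i : Fin m, ∃ a : Fin (m - 2), ∃ b : Fin (d - 2),
      x = Sum.inl i ∧ y = Sum.inr (a, b) ∧ i.val = a.val + 1))


/-- The position of a vertex of the broom `B_{n,d}` along its handle; all leaves have
position `d`. -/
def broomPos {n : ℕ} (d : ℕ) (u : Fin n) : ℕ := min u.val d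

lemma broomPos_le {n d : ℕ} (u : Fin n) : broomPos d u ≤ d := min_le_right _ _

lemma broomPos_of_lt {n d : ℕ} {u : Fin n} (h : u.val < d) : broomPos d u = u.val :=
  min_eq_left h.le

lemma broomPos_of_le {n d : ℕ} {u : Fin n} (h : d ≤ u.val) : broomPos d u = d :=
  min_eq_right h

lemma broom_adj {n d : ℕ} {u v : Fin n} : (broom n d).Adj u v ↔
    (broomPos d u + 1 = broomPos d v ∨ broomPos d v + 1 = broomPos d u) := by
  simp only [broom, SimpleGraph.fromRel_adj, broomPos, ne_eq, Fin.ext_iff]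
  omega

lemma sum_broomPos {n d : ℕ} (h : d ≤ n) (f : ℕ → ℕ) :
    ∑ u : Fin n, f (broomPos d u) = ∑ j ∈ range d, f j + (n - d) * f d := by
  obtain ⟨m, rfl⟩ := Nat.exists_eq_add_of_le h
  unfold broomPos
  rw [Fin.sum_univ_eq_sum_range (fun j => f (min j d)), sum_range_add]
  congr 1
  · exact sum_congr rfl fun j hj => by rw [min_eq_left (mem_range.1 hj).le]
  · simp

lemma exists_broom_walk {n d : ℕ} (m : ℕ) (u v : Fin n)
    (hu : u.val < d) (h : broomPos d u + m = broomPos d v) :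
    ∃ p : (broom n d).Walk u v, p.length = m := by
  induction m generalizing u with
  | zero =>
    have : u = v := by
      simp only [broomPos] at h
      ext
      omega
    subst this
    exact ⟨.nil, rfl⟩
  | succ m ih =>
    rcases Nat.eq_zero_or_pos m with rfl | hm
    · exact ⟨.cons (broom_adj.2 (Or.inl h)) .nil, rfl⟩
    · have hud : u.val + 1 < d := by
        simp only [broomPos] at h
        omega
      have hun : u.val + 1 < n := by
        simp only [broomPos] at h
        omega
      let w : Fin n := ⟨u.val + 1, hun⟩
      have hw : w.val < d := hud
      have hp : broomPos d u + 1 = broomPos d w := by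
        rw [broomPos_of_lt hu, broomPos_of_lt hw]
      obtain ⟨p, hpm⟩ := ih w hw (by omega)
      exact ⟨.cons (broom_adj.2 (Or.inl hp)) p, by rw [SimpleGraph.Walk.length_cons, hpm]⟩

lemma exists_broom_walk_of_lt {n d : ℕ} (u v : Fin n) (hu : u.val < d) :
    ∃ p : (broom n d).Walk u v,
      p.length = (broomPos d v - broomPos d u) + (broomPos d u - broomPos d v) := by
  rcases le_total (broomPos d u) (broomPos d v) with h | h
  · exact exists_broom_walk _ u v hu (by omega)
  · have hv : v.val < d ∨ u = v := by
      simp only [broomPos] at h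
      omega
    rcases hv with hv | rfl
    · obtain ⟨p, hp⟩ := exists_broom_walk (broomPos d u - broomPos d v) v u hv (by omega)
      exact ⟨p.reverse, by rw [SimpleGraph.Walk.length_reverse]; omega⟩
    · exact ⟨.nil, by simp⟩

lemma broom_connected {n d : ℕ} (hn : 0 < n) (hd : 0 < d) : (broom n d).Connected := by
  have h (v : Fin n) : (broom n d).Reachable ⟨0, hn⟩ v :=
    (exists_broom_walk_of_lt ⟨0, hn⟩ v hd).choose.reachable
  exact { preconnected := fun u v => (h u).symm.trans (h v), nonempty := ⟨⟨0, hn⟩⟩ }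

lemma broomPos_sub_le_length {n d : ℕ} {u v : Fin n} (p : (broom n d).Walk u v) :
    (broomPos d v - broomPos d u) + (broomPos d u - broomPos d v) ≤ p.length := by
  induction p with
  | nil => simp
  | cons h p ih =>
    rw [broom_adj] at h
    rw [SimpleGraph.Walk.length_cons]
    omega

lemma broomPos_sub_le_dist {n d : ℕ} (hd : 0 < d) (u v : Fin n) :
    (broomPos d v - broomPos d u) + (broomPos d u - broomPos d v) ≤ (broom n d).dist u v := by
  obtain ⟨p, hp⟩ := (broom_connected u.pos hd).exists_walk_length_eq_dist u v
  exact hp ▸ broomPos_sub_le_length p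

lemma broom_dist_of_lt {n d : ℕ} (u v : Fin n) (hu : u.val < d) : (broom n d).dist u v =
    (broomPos d v - broomPos d u) + (broomPos d u - broomPos d v) := by
  obtain ⟨p, hp⟩ := exists_broom_walk_of_lt u v hu
  exact le_antisymm (hp ▸ SimpleGraph.dist_le p) (broomPos_sub_le_dist (by omega) u v)

lemma treeWeight_eq_sum_dist [Fintype V] (G : SimpleGraph V) (v : V) :
    treeWeight G v = ∑ u, G.dist v u :=
  sum_congr rfl fun _ _ => SimpleGraph.dist_comm

/-- When the leaves outnumber the handle, the weight from a vertex is smallest, strictly, at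
the end of the handle carrying the leaves. -/
lemma treeWeight_broom_lt {n d : ℕ} (hd : 2 ≤ d) (hn : 2 * d < n) (c v : Fin n)
    (hc : c.val + 1 = d) (hv : v ≠ c) :
    treeWeight (broom n d) c < treeWeight (broom n d) v := by
  have hpc : broomPos d c = c.val := broomPos_of_lt (by omega)
  have hvc : v.val ≠ c.val := fun h => hv (Fin.ext h)
  simp only [treeWeight_eq_sum_dist]
  rcases lt_or_ge v.val d with hvd | hvd
  · obtain ⟨t, ht⟩ : ∃ t, v.val + t + 1 = d := ⟨d - 1 - v.val, by omega⟩
    have key : ∑ u : Fin n, ((broom n d).dist c u + if broomPos d u < d then 0 else t) ≤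
        ∑ u : Fin n, ((broom n d).dist v u + if broomPos d u < d then t else 0) := by
      refine sum_le_sum fun u _ => ?_
      rw [broom_dist_of_lt c u (by omega), broom_dist_of_lt v u hvd, hpc, broomPos_of_lt hvd]
      have := broomPos_le (d := d) u
      split_ifs <;> omega
    rw [sum_add_distrib, sum_add_distrib, sum_broomPos (by omega) (fun j => if j < d then 0 else t),
      sum_broomPos (by omega) (fun j => if j < d then t else 0),
      sum_congr rfl (g := fun _ => 0) (fun j hj => if_pos (mem_range.1 hj)),
      sum_congr rfl (g := fun _ => t) (fun j hj => if_pos (mem_range.1 hj))] at key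
    simp only [sum_const, card_range, lt_irrefl, if_false, smul_eq_mul, mul_zero, zero_add,
      add_zero] at key
    have : d * t < (n - d) * t := Nat.mul_lt_mul_of_pos_right (by omega) (by omega)
    omega
  · have key : ∑ u : Fin n, ((broom n d).dist c u + if broomPos d u < d then 1 else 0) ≤
        ∑ u : Fin n, ((broom n d).dist v u + if u = v then 1 else 0) := by
      refine sum_le_sum fun u _ => ?_
      have h₁ := broomPos_sub_le_dist (by omega : 0 < d) v u
      have h₂ := broomPos_le (d := d) u
      rw [broom_dist_of_lt c u (by omega), hpc]
      rw [broomPos_of_le hvd] at h₁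
      by_cases huv : u = v
      · subst huv
        rw [broomPos_of_le hvd]
        simp
        omega
      · have := (broom_connected v.pos (by omega : 0 < d)).pos_dist_of_ne (Ne.symm huv)
        rw [if_neg huv]
        split_ifs <;> omega
    rw [sum_add_distrib, sum_add_distrib, sum_broomPos (by omega) (fun j => if j < d then 1 else 0),
      sum_congr rfl (g := fun _ => 1) (fun j hj => if_pos (mem_range.1 hj))] at key
    simp at key
    omega

lemma weightCenters_broom {n d : ℕ} (hd : 2 ≤ d) (hn : 2 * d < n) (c : Fin n)
    (hc : c.val + 1 = d) : WeightCenters (broom n d) = {c} := by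
  ext v
  simp only [WeightCenters, Set.mem_ofPred_eq, Set.mem_singleton_iff]
  refine ⟨fun h => by_contra fun hv => ?_, ?_⟩
  · exact absurd (h c) (not_le.2 (treeWeight_broom_lt hd hn c v hc hv))
  · rintro rfl u
    by_cases hu : u = v
    · rw [hu]
    · exact (treeWeight_broom_lt hd hn v u hc hu).le

lemma dist_le_ecc [Finite V] (G : SimpleGraph V) (u v : V) :
    G.dist u v ≤ ecc G u :=
  le_csSup (Set.finite_range _).bddAbove ⟨v, rfl⟩

lemma graphCenter_broom {n k : ℕ} (hk : 0 < k) (hn : 2 * k < n) (c : Fin n)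
    (hc : c.val = k) : graphCenter (broom n (2 * k)) = {c} := by
  have hpc : broomPos (2 * k) c = k := by rw [broomPos_of_lt (by omega), hc]
  have hec : ecc (broom n (2 * k)) c ≤ k := by
    refine csSup_le ⟨_, c, rfl⟩ ?_
    rintro _ ⟨u, rfl⟩
    have := broomPos_le (d := 2 * k) u
    simp only [broom_dist_of_lt c u (by omega : c.val < 2 * k), hpc]
    omega
  have hlt (v : Fin n) (hv : v ≠ c) : k < ecc (broom n (2 * k)) v := by
    have hvc : v.val ≠ c.val := fun h => hv (Fin.ext h)
    have hpv : broomPos (2 * k) v ≠ k := by simp only [broomPos]; omega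
    have hle := broomPos_le (d := 2 * k) v
    have h₁ := broomPos_sub_le_dist (by omega : 0 < 2 * k) v ⟨0, by omega⟩
    have h₂ := broomPos_sub_le_dist (by omega : 0 < 2 * k) v ⟨2 * k, hn⟩
    have h₃ := dist_le_ecc (broom n (2 * k)) v ⟨0, by omega⟩
    have h₄ := dist_le_ecc (broom n (2 * k)) v ⟨2 * k, hn⟩
    rw [broomPos_of_lt (u := ⟨0, _⟩) (by simpa using hk)] at h₁
    rw [broomPos_of_le (u := ⟨2 * k, _⟩) le_rfl] at h₂
    simp only at h₁ h₂
    omega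
  ext v
  simp only [graphCenter, Set.mem_ofPred_eq, Set.mem_singleton_iff]
  refine ⟨fun h => by_contra fun hv => ?_, ?_⟩
  · exact absurd (h c) (not_le.2 (hec.trans_lt (hlt v hv)))
  · rintro rfl u
    by_cases hu : u = v
    · rw [hu]
    · exact (hec.trans_lt (hlt u hu)).le

lemma totalDetourLevel_of_singleton [Fintype V] {G : SimpleGraph V} {c : V}
    (h : WeightCenters G = {c}) : totalDetourLevel G = ∑ u, G.dist c u := by
  refine sum_congr rfl fun u _ => ?_
  simp [detourLevel, h, SimpleGraph.dist_comm (u := c)]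

lemma totalLevel_of_singleton [Fintype V] {G : SimpleGraph V} {c : V}
    (h : graphCenter G = {c}) : totalLevel G = ∑ u, G.dist c u := by
  refine sum_congr rfl fun u _ => ?_
  simp [h, SimpleGraph.dist_comm (u := c)]

lemma sum_dist_broom {n d : ℕ} (hn : d ≤ n) (c : Fin n) (hc : c.val < d) :
    ∑ u, (broom n d).dist c u =
      ∑ j ∈ range d, ((j - c.val) + (c.val - j)) + (n - d) * (d - c.val) := by
  simp only [broom_dist_of_lt c _ hc, broomPos_of_lt hc]
  rw [sum_broomPos hn fun j => (j - c.val) + (c.val - j)]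
  congr 2
  omega

lemma sum_range_two_mul_abs_sub (k : ℕ) :
    ∑ j ∈ range (2 * k), ((j - k) + (k - j)) = k * k := by
  rw [two_mul, sum_range_add, ← sum_add_distrib,
    sum_congr rfl (g := fun _ => k) fun j hj => by have := mem_range.1 hj; omega]
  simp

lemma sum_range_two_mul_sub_last {k : ℕ} (hk : 0 < k) :
    ∑ j ∈ range (2 * k), ((j - (2 * k - 1)) + (2 * k - 1 - j)) = k * (2 * k - 1) := by
  rw [sum_congr rfl (g := fun j => 2 * k - 1 - j) fun j hj => by have := mem_range.1 hj; omega,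
    sum_range_reflect (fun j => j), sum_range_id, mul_assoc, Nat.mul_div_cancel_left _ two_pos]

/-- For `k ≥ 2`, `lb_W(B_{2k}) - lb(B_{2k}) = 4k(k-1)² > 0`. -/
theorem stmt14 (k : ℕ) (hk : 2 ≤ k) :
    lbW (broom (k * (2 * k + 1)) (2 * k)) - lbC (broom (k * (2 * k + 1)) (2 * k)) =
      4 * (k : ℤ) * ((k : ℤ) - 1) ^ 2 ∧
    0 < lbW (broom (k * (2 * k + 1)) (2 * k)) - lbC (broom (k * (2 * k + 1)) (2 * k)) := by
  have hn : 2 * (2 * k) < k * (2 * k + 1) := by nlinarith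
  have hW := weightCenters_broom (by omega) hn ⟨2 * k - 1, by omega⟩ (by simp only; omega)
  have hC := graphCenter_broom (by omega : 0 < k) (by omega) (⟨k, by omega⟩ :
    Fin (k * (2 * k + 1))) rfl
  have hsub : k * (2 * k + 1) - 2 * k = k * (2 * k - 1) := by
    rw [mul_comm 2 k, ← Nat.mul_sub, show k * 2 + 1 - 2 = k * 2 - 1 by omega]
  have hLW : totalDetourLevel (broom (k * (2 * k + 1)) (2 * k)) = 2 * (k * (2 * k - 1)) := by
    rw [totalDetourLevel_of_singleton hW, sum_dist_broom (by omega) _ (by simp only; omega), hsub]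
    simp only [sum_range_two_mul_sub_last (by omega : 0 < k)]
    rw [show 2 * k - (2 * k - 1) = 1 by omega]
    ring
  have hL : totalLevel (broom (k * (2 * k + 1)) (2 * k)) = k * k + k * (2 * k - 1) * k := by
    rw [totalLevel_of_singleton hC, sum_dist_broom (by omega) _ (by simp only; omega), hsub]
    simp only [sum_range_two_mul_abs_sub]
    rw [show 2 * k - k = k by omega]
  have heq : lbW (broom (k * (2 * k + 1)) (2 * k)) - lbC (broom (k * (2 * k + 1)) (2 * k)) =
      4 * (k : ℤ) * ((k : ℤ) - 1) ^ 2 := by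
    have hcast : ((2 * k - 1 : ℕ) : ℤ) = 2 * k - 1 := by omega
    simp only [lbW, lbC, zeta', eps', zeta, eps, hW, hC, Set.ncard_singleton, hLW, hL]
    push_cast [hcast]
    ring
  refine ⟨heq, heq ▸ ?_⟩
  have : (0 : ℤ) < k - 1 := by omega
  positivity

end HCPaper
end

section
/- For every integer n ≥ 3, the hamiltonian chromatic number of the star K_{1,n−1} of order n is hc(K_{1,n−1}) = (n−2)². -/
open SimpleGraph Finset

namespace HCPaper

variable {V : Type*}

theorem detourDist_eq_length_of_isAcyclic {G : SimpleGraph V} (hG : G.IsAcyclic) {u v : V}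
    {p : G.Walk u v} (hp : p.IsPath) : detourDist G u v = p.length := by
  have hset : {n | ∃ q : G.Walk u v, q.IsPath ∧ q.length = n} = {p.length} := by
    ext n
    constructor
    · rintro ⟨q, hq, rfl⟩
      have := congrArg Subtype.val ((hG.subsingleton_path u v).elim ⟨q, hq⟩ ⟨p, hp⟩)
      exact congrArg Walk.length this
    · rintro rfl
      exact ⟨p, hp, rfl⟩
  rw [detourDist, hset, csSup_singleton]

theorem starGraph_succ (n : ℕ) : starGraph (n + 1) = SimpleGraph.starGraph (0 : Fin (n + 1)) := by
  ext i j
  simp [starGraph]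

theorem detourDist_starGraph (n : ℕ) {u v : Fin (n + 1)} (huv : u ≠ v) :
    detourDist (starGraph (n + 1)) u v = if u = 0 ∨ v = 0 then 1 else 2 := by
  rw [starGraph_succ]
  have hG := isAcyclic_starGraph (0 : Fin (n + 1))
  split_ifs with h
  · have hadj : (SimpleGraph.starGraph (0 : Fin (n + 1))).Adj u v := by simp [huv, h]
    simpa using detourDist_eq_length_of_isAcyclic hG (Walk.IsPath.of_adj hadj)
  · push Not at h
    have hu := starGraph_center_adj' h.1.symm
    have hv := starGraph_center_adj h.2.symm
    have hp : (Walk.cons hu (Walk.cons hv Walk.nil)).IsPath := by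
      simp [huv, h.1, h.2.symm]
    simpa using detourDist_eq_length_of_isAcyclic hG hp

theorem isHamiltonianColoring_starGraph_iff (k : ℕ) (h : Fin (k + 3) → ℕ) :
    IsHamiltonianColoring (starGraph (k + 3)) h ↔
      (∀ v, v ≠ 0 → k + 1 ≤ Nat.dist (h 0) (h v)) ∧
        ∀ u v, u ≠ 0 → v ≠ 0 → u ≠ v → k ≤ Nat.dist (h u) (h v) := by
  constructor
  · intro H
    refine ⟨fun v hv => ?_, fun u v hu hv huv => ?_⟩
    · have := H 0 v hv.symm
      rw [detourDist_starGraph _ hv.symm, if_pos (Or.inl rfl), Fintype.card_fin] at this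
      omega
    · have := H u v huv
      rw [detourDist_starGraph _ huv, if_neg (by simp [hu, hv]), Fintype.card_fin] at this
      omega
  · rintro ⟨hc, hl⟩ u v huv
    rw [detourDist_starGraph _ huv, Fintype.card_fin]
    split_ifs with h0
    · rcases h0 with rfl | rfl
      · have := hc v huv.symm
        omega
      · have := hc u huv
        rw [Nat.dist_comm] at this
        omega
    · push Not at h0
      have := hl u v h0.1 h0.2 huv
      omega

theorem dist_le_spanOf [Finite V] (h : V → ℕ) (u v : V) : Nat.dist (h u) (h v) ≤ spanOf h :=
  le_csSup (Set.finite_range _).bddAbove ⟨(u, v), rfl⟩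

/-- Naturals that are pairwise at distance at least `k` spread over at least `k` times the number
of gaps between them. -/
theorem exists_add_mul_card_le {ι : Type*} (f : ι → ℕ) (k : ℕ) (s : Finset ι)
    (hs : s.Nonempty) (hk : ∀ i ∈ s, ∀ j ∈ s, i ≠ j → k ≤ Nat.dist (f i) (f j)) :
    ∃ i ∈ s, ∃ j ∈ s, f i + k * (#s - 1) ≤ f j := by
  classical
  induction s using Finset.induction_on_max_value f with
  | empty => simp at hs
  | insert a s ha hmax ih =>
    rcases s.eq_empty_or_nonempty with rfl | hne
    · exact ⟨a, by simp, a, by simp, by simp⟩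
    obtain ⟨i, hi, j, hj, hij⟩ := ih hne fun i hi j hj =>
      hk i (mem_insert_of_mem hi) j (mem_insert_of_mem hj)
    refine ⟨i, mem_insert_of_mem hi, a, mem_insert_self a s, ?_⟩
    have hja := hk j (mem_insert_of_mem hj) a (mem_insert_self a s) (by rintro rfl; exact ha hj)
    rw [Nat.dist_eq_sub_of_le (hmax j hj)] at hja
    obtain ⟨m, hm⟩ := Nat.exists_eq_succ_of_ne_zero (card_pos.mpr hne).ne'
    rw [card_insert_of_notMem ha, Nat.add_sub_cancel, hm]
    rw [hm, Nat.succ_sub_one] at hij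
    have := hmax j hj
    rw [Nat.mul_succ]
    omega

theorem sq_le_spanOf_starGraph (k : ℕ) (h : Fin (k + 3) → ℕ)
    (H : IsHamiltonianColoring (starGraph (k + 3)) h) : (k + 1) ^ 2 ≤ spanOf h := by
  obtain ⟨hc, hl⟩ := (isHamiltonianColoring_starGraph_iff k h).mp H
  have hspan := dist_le_spanOf h
  rcases k.eq_zero_or_pos with rfl | hk
  · exact (hc 1 (by decide)).trans (hspan 0 1)
  simp only [Nat.dist] at hc hl hspan
  -- Moving every leaf color one step towards the center color keeps all colors `k` apart.
  let g : Fin (k + 3) → ℕ := fun v =>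
    if v = 0 then h v else if h v < h 0 then h v + 1 else h v - 1
  have hg : ∀ i ∈ univ, ∀ j ∈ univ, i ≠ j → k ≤ Nat.dist (g i) (g j) := by
    intro i _ j _ hij
    simp only [g, Nat.dist]
    by_cases hi : i = 0
    · subst hi
      have := hc j hij.symm
      grind
    by_cases hj : j = 0
    · subst hj
      have := hc i hi
      grind
    have := hl i j hi hj hij
    have := hc i hi
    have := hc j hj
    simp only [hi, hj, if_false]
    split_ifs <;> omega
  obtain ⟨i, -, j, -, hij⟩ := exists_add_mul_card_le g k univ univ_nonempty hg
  have hcard : k * (#(univ : Finset (Fin (k + 3))) - 1) + 1 = (k + 1) ^ 2 := by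
    rw [card_fin, Nat.add_sub_assoc (by norm_num)]
    ring
  have hpos : k < (k + 1) ^ 2 := by nlinarith
  have h1 := hspan i j
  have h2 := hspan 0 j
  have h3 := hspan i 0
  have hci := hc i
  have hcj := hc j
  simp only [g] at hij
  generalize (k + 1) ^ 2 = S at *
  generalize k * (#(univ : Finset (Fin (k + 3))) - 1) = M at *
  split_ifs at hij <;> subst_vars <;> omega

/-- The coloring of the star with the center colored `0` and the leaves colored
`k + 1, 2 * k + 1, 3 * k + 1, …`. -/
def starColoring (k : ℕ) (v : Fin (k + 3)) : ℕ := if v = 0 then 0 else v.val * k + 1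

theorem isHamiltonianColoring_starColoring (k : ℕ) :
    IsHamiltonianColoring (starGraph (k + 3)) (starColoring k) := by
  refine (isHamiltonianColoring_starGraph_iff k _).mpr ⟨fun v hv => ?_, fun u v hu hv huv => ?_⟩
  · have : 1 ≤ v.val := Nat.one_le_iff_ne_zero.mpr (Fin.val_ne_zero_iff.mpr hv)
    simp only [starColoring, hv, if_true, if_false, Nat.dist]
    have := Nat.le_mul_of_pos_left k this
    omega
  · simp only [starColoring, hu, hv, if_false, Nat.dist_add_add_right, Nat.dist_mul_right]
    exact Nat.le_mul_of_pos_left k (Nat.dist_pos_of_ne (Fin.val_ne_of_ne huv))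

theorem spanOf_starColoring_le (k : ℕ) : spanOf (starColoring k) ≤ (k + 1) ^ 2 := by
  have hle : ∀ v, starColoring k v ≤ (k + 1) ^ 2 := by
    intro v
    unfold starColoring
    split_ifs
    · exact Nat.zero_le _
    · have := Nat.mul_le_mul_right k (Nat.le_of_lt_succ v.isLt)
      nlinarith
  refine csSup_le (Set.range_nonempty _) ?_
  rintro _ ⟨p, rfl⟩
  have := hle p.1
  have := hle p.2
  simp only [Nat.dist]
  omega

/-- `hc(K_{1,n-1}) = (n-2)²` for `n ≥ 3`. -/
theorem stmt17 (n : ℕ) (hn : 3 ≤ n) :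
    hc (starGraph n) = (n - 2) ^ 2 := by
  obtain ⟨k, rfl⟩ := Nat.exists_eq_add_of_le' hn
  have H := isHamiltonianColoring_starColoring k
  apply le_antisymm
  · refine le_trans (Nat.sInf_le ?_) (spanOf_starColoring_le k)
    exact ⟨_, H, rfl⟩
  · apply le_csInf
    · exact ⟨_, starColoring k, H, rfl⟩
    rintro _ ⟨h, hh, rfl⟩
    exact sq_le_spanOf_starGraph k h hh

end HCPaper
end

section
/- Let d ≥ 3 and let m = 2k ≥ 4 be even. Then the hamiltonian chromatic number of the caterpillar C(m,d) is hc(C(m,d)) = ((2d−3)/(2d−2))(n−2)², where n = (2k−2)(d−1) + 2 is the order of C(m,d); equivalently, hc(C(m,d)) = 2(2d−3)(d−1)(k−1)². -/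
open SimpleGraph Finset

namespace HCPaper

variable {V : Type*}

/-- The (zero-based) index of the spine vertex at which a caterpillar vertex sits. -/
def spinePos {m d : ℕ} : Fin m ⊕ Fin (m - 2) × Fin (d - 2) → ℕ
  | Sum.inl i => i.val
  | Sum.inr p => p.1.val + 1

/-- `0` on the spine and `1` on the legs: the distance from a vertex to the spine. -/
def legHeight {m d : ℕ} : Fin m ⊕ Fin (m - 2) × Fin (d - 2) → ℕ
  | Sum.inl _ => 0
  | Sum.inr _ => 1

/-- The explicit formula for the distance in the caterpillar. -/
def catDist {m d : ℕ} (u v : Fin m ⊕ Fin (m - 2) × Fin (d - 2)) : ℕ :=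
  if u = v then 0 else
    (spinePos u - spinePos v) + (spinePos v - spinePos u) + legHeight u + legHeight v

/-- The distance of a vertex of `C(2k,d)` from the nearest of the two central spine vertices. -/
def catLevel {m d : ℕ} (k : ℕ) (u : Fin m ⊕ Fin (m - 2) × Fin (d - 2)) : ℕ :=
  (if spinePos u < k then k - 1 - spinePos u else spinePos u - k) + legHeight u

section Caterpillar

variable {m d : ℕ}

lemma legHeight_le_one (u : Fin m ⊕ Fin (m - 2) × Fin (d - 2)) : legHeight u ≤ 1 := by
  rcases u with i | p <;> simp [legHeight]

lemma spinePos_lt (u : Fin m ⊕ Fin (m - 2) × Fin (d - 2)) : spinePos u + legHeight u < m := by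
  rcases u with i | p
  · simp [legHeight, spinePos]
  · have := p.1.isLt
    simp only [legHeight, spinePos]; omega

lemma legHeight_le_spinePos (u : Fin m ⊕ Fin (m - 2) × Fin (d - 2)) :
    legHeight u ≤ spinePos u := by
  rcases u with i | p <;> simp [legHeight, spinePos]

lemma eq_of_legHeight_eq_zero {u v : Fin m ⊕ Fin (m - 2) × Fin (d - 2)}
    (hu : legHeight u = 0) (hv : legHeight v = 0) (h : spinePos u = spinePos v) : u = v := by
  rcases u with i | p <;> rcases v with j | q <;> simp_all [legHeight, spinePos, Fin.ext_iff]

lemma not_spine_and_spinePos_eq_of_ne {u v : Fin m ⊕ Fin (m - 2) × Fin (d - 2)} (h : u ≠ v) :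
    ¬ (legHeight u = 0 ∧ legHeight v = 0 ∧ spinePos u = spinePos v) :=
  fun e => h (eq_of_legHeight_eq_zero e.1 e.2.1 e.2.2)

lemma caterpillar_adj_iff (u v : Fin m ⊕ Fin (m - 2) × Fin (d - 2)) :
    (caterpillar m d).Adj u v ↔
      (legHeight u = 0 ∧ legHeight v = 0 ∧
        (spinePos u + 1 = spinePos v ∨ spinePos v + 1 = spinePos u)) ∨
      (spinePos u = spinePos v ∧ legHeight u + legHeight v = 1) := by
  rcases u with i | ⟨a, b⟩ <;> rcases v with j | ⟨a', b'⟩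
  · simp only [caterpillar, fromRel_adj, legHeight, spinePos]
    constructor
    · rintro ⟨-, (⟨a, b, ha, hb, h⟩ | ⟨a, b, c, ha, hb, h⟩) |
        (⟨a, b, ha, hb, h⟩ | ⟨a, b, c, ha, hb, h⟩)⟩
      · obtain rfl := Sum.inl_injective ha
        obtain rfl := Sum.inl_injective hb
        exact Or.inl ⟨trivial, trivial, Or.inl h⟩
      · simp at hb
      · obtain rfl := Sum.inl_injective ha
        obtain rfl := Sum.inl_injective hb
        exact Or.inl ⟨trivial, trivial, Or.inr h⟩
      · simp at hb
    · rintro (⟨-, -, h⟩ | ⟨-, h⟩)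
      · refine ⟨fun e => ?_, ?_⟩
        · obtain rfl := Sum.inl_injective e
          omega
        · rcases h with h | h
          · exact Or.inl (Or.inl ⟨i, j, rfl, rfl, h⟩)
          · exact Or.inr (Or.inl ⟨j, i, rfl, rfl, h⟩)
      · simp at h
  · simp [caterpillar, legHeight, spinePos]
  · simp [caterpillar, legHeight, spinePos, eq_comm]
  · simp [caterpillar, legHeight, spinePos]

lemma catDist_self (u : Fin m ⊕ Fin (m - 2) × Fin (d - 2)) : catDist u u = 0 := by
  simp [catDist]

lemma catDist_of_ne {u v : Fin m ⊕ Fin (m - 2) × Fin (d - 2)} (h : u ≠ v) :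
    catDist u v = (spinePos u - spinePos v) + (spinePos v - spinePos u) +
      legHeight u + legHeight v := by
  simp [catDist, h]

lemma catDist_comm (u v : Fin m ⊕ Fin (m - 2) × Fin (d - 2)) : catDist u v = catDist v u := by
  simp only [catDist, eq_comm (a := u)]
  split_ifs <;> omega

lemma catDist_le_add_one_of_adj {u u' : Fin m ⊕ Fin (m - 2) × Fin (d - 2)}
    (h : (caterpillar m d).Adj u u') (v : Fin m ⊕ Fin (m - 2) × Fin (d - 2)) :
    catDist u v ≤ catDist u' v + 1 := by
  have hu := legHeight_le_one u
  have hne := h.ne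
  rw [caterpillar_adj_iff] at h
  by_cases huv : u = v
  · simp [huv, catDist_self]
  by_cases huv' : u' = v
  · subst huv'
    rw [catDist_self, catDist_of_ne huv]
    omega
  · rw [catDist_of_ne huv, catDist_of_ne huv']
    omega

lemma catDist_le_length {u v : Fin m ⊕ Fin (m - 2) × Fin (d - 2)}
    (p : (caterpillar m d).Walk u v) : catDist u v ≤ p.length := by
  induction p with
  | nil => simp [catDist_self]
  | cons h q ih =>
    have := catDist_le_add_one_of_adj h
    rw [Walk.length_cons]
    exact (this _).trans (by omega)

/-- A walk avoiding `c` cannot leave a set whose only exits lead to `c`. -/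
lemma mem_of_walk_avoiding {V : Type*} {G : SimpleGraph V} {S : Set V} {c u v : V}
    (hS : ∀ x ∈ S, ∀ y, G.Adj x y → y ≠ c → y ∈ S) (p : G.Walk u v) (hu : u ∈ S)
    (hc : c ∉ p.support) : v ∈ S := by
  induction p with
  | nil => exact hu
  | cons h q ih =>
    rw [Walk.support_cons, List.mem_cons, not_or] at hc
    exact ih (hS _ hu _ h fun e => hc.2 (e ▸ q.start_mem_support)) hc.2

lemma catDist_add_one_le {u u' v : Fin m ⊕ Fin (m - 2) × Fin (d - 2)}
    (h : (caterpillar m d).Adj u u') (q : (caterpillar m d).Walk u' v) (hq : u ∉ q.support) :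
    catDist u' v + 1 ≤ catDist u v := by
  have huv : u ≠ v := fun e => hq (e ▸ q.end_mem_support)
  have hu1 := legHeight_le_one u
  have hv1 := legHeight_le_one v
  have hu1' := legHeight_le_one u'
  rw [caterpillar_adj_iff] at h
  rw [catDist_of_ne huv]
  by_cases huv' : u' = v
  · subst huv'
    rw [catDist_self]
    omega
  rw [catDist_of_ne huv']
  rcases h with ⟨h0, h0', hp | hp⟩ | ⟨hp, h1⟩
  · have : spinePos u < spinePos v := by
      refine mem_of_walk_avoiding (S := {x | spinePos u < spinePos x}) (c := u)
        (fun x hx y hxy hy => ?_) q (by simp; omega) hq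
      rw [caterpillar_adj_iff] at hxy
      simp only [Set.mem_ofPred_eq] at hx ⊢
      have := not_spine_and_spinePos_eq_of_ne hy
      omega
    omega
  · have : spinePos v < spinePos u := by
      refine mem_of_walk_avoiding (S := {x | spinePos x < spinePos u}) (c := u)
        (fun x hx y hxy hy => ?_) q (by simp; omega) hq
      rw [caterpillar_adj_iff] at hxy
      simp only [Set.mem_ofPred_eq] at hx ⊢
      have := not_spine_and_spinePos_eq_of_ne hy
      omega
    omega
  · by_cases h0 : legHeight u = 0
    · exfalso
      refine huv' (mem_of_walk_avoiding (S := {u'}) (c := u)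
        (fun x hx y hxy hy => ?_) q rfl hq).symm
      rw [Set.mem_singleton_iff] at hx
      subst hx
      rw [caterpillar_adj_iff] at hxy
      have := not_spine_and_spinePos_eq_of_ne hy
      omega
    · omega

lemma length_le_catDist {u v : Fin m ⊕ Fin (m - 2) × Fin (d - 2)}
    (p : (caterpillar m d).Walk u v) (hp : p.IsPath) : p.length ≤ catDist u v := by
  induction p with
  | nil => simp
  | cons h q ih =>
    rw [Walk.cons_isPath_iff] at hp
    have h₁ := catDist_add_one_le h q hp.2
    have h₂ := ih hp.1
    rw [Walk.length_cons]
    omega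

lemma caterpillar_reachable_spine (i j : Fin m) :
    (caterpillar m d).Reachable (Sum.inl i) (Sum.inl j) := by
  have key : ∀ n (hn : n < m), (caterpillar m d).Reachable
      (Sum.inl ⟨0, by omega⟩) (Sum.inl ⟨n, hn⟩) := by
    intro n
    induction n with
    | zero => intro _; rfl
    | succ n ih =>
      intro hn
      refine (ih (by omega)).trans (Adj.reachable ?_)
      rw [caterpillar_adj_iff]
      simp [legHeight, spinePos]
  exact (key i i.isLt).symm.trans (key j j.isLt)

lemma caterpillar_preconnected : (caterpillar m d).Preconnected := by
  have key : ∀ u : Fin m ⊕ Fin (m - 2) × Fin (d - 2),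
      ∃ i : Fin m, (caterpillar m d).Reachable u (Sum.inl i) := by
    rintro (i | ⟨a, b⟩)
    · exact ⟨i, Reachable.refl _⟩
    · refine ⟨⟨a.val + 1, by omega⟩, Adj.reachable ?_⟩
      rw [caterpillar_adj_iff]
      simp [legHeight, spinePos]
  intro u v
  obtain ⟨i, hi⟩ := key u
  obtain ⟨j, hj⟩ := key v
  exact hi.trans ((caterpillar_reachable_spine i j).trans hj.symm)

lemma detourDist_caterpillar (u v : Fin m ⊕ Fin (m - 2) × Fin (d - 2)) :
    detourDist (caterpillar m d) u v = catDist u v := by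
  obtain ⟨p, hp⟩ := (caterpillar_preconnected (m := m) (d := d) u v).exists_isPath
  have hb : ∀ n ∈ {n | ∃ p : (caterpillar m d).Walk u v, p.IsPath ∧ p.length = n},
      n ≤ catDist u v := by
    rintro _ ⟨q, hq, rfl⟩
    exact length_le_catDist q hq
  refine le_antisymm (csSup_le ⟨_, p, hp, rfl⟩ hb) ?_
  exact (catDist_le_length p).trans (le_csSup ⟨_, hb⟩ ⟨p, hp, rfl⟩)

end Caterpillar

section EvenSpine

variable {k d : ℕ}

lemma catDist_le_catLevel
    (u v : Fin (2 * k) ⊕ Fin (2 * k - 2) × Fin (d - 2)) :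
    catDist u v ≤ catLevel k u + catLevel k v + 1 := by
  have := spinePos_lt u
  have := spinePos_lt v
  unfold catDist catLevel
  split_ifs <;> omega

lemma catDist_of_opposite (u v : Fin (2 * k) ⊕ Fin (2 * k - 2) × Fin (d - 2))
    (huv : spinePos u < k ↔ ¬ spinePos v < k) :
    catDist u v = catLevel k u + catLevel k v + 1 := by
  have hne : u ≠ v := by rintro rfl; tauto
  rw [catDist_of_ne hne]
  unfold catLevel
  split_ifs <;> omega

lemma catLevel_le (hk : 2 ≤ k) (u : Fin (2 * k) ⊕ Fin (2 * k - 2) × Fin (d - 2)) :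
    catLevel k u ≤ k - 1 := by
  have := spinePos_lt u
  have := legHeight_le_spinePos u
  unfold catLevel
  split_ifs <;> omega

lemma catLevel_add_le_of_ne (hk : 2 ≤ k) {u v : Fin (2 * k) ⊕ Fin (2 * k - 2) × Fin (d - 2)}
    (hne : u ≠ v) : catLevel k u + catLevel k v ≤ catDist u v + (2 * k - 3) := by
  have h1 := spinePos_lt u
  have h2 := spinePos_lt v
  have h3 := legHeight_le_spinePos u
  have h4 := legHeight_le_spinePos v
  have h5 := not_spine_and_spinePos_eq_of_ne hne
  rw [catDist_of_ne hne]
  unfold catLevel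
  split_ifs <;> omega

lemma card_caterpillar (hk : 2 ≤ k) (hd : 3 ≤ d) :
    Fintype.card (Fin (2 * k) ⊕ Fin (2 * k - 2) × Fin (d - 2)) =
      2 * ((k - 1) * (d - 1) + 1) := by
  obtain ⟨k, rfl⟩ := Nat.exists_eq_add_of_le hk
  obtain ⟨d, rfl⟩ := Nat.exists_eq_add_of_le hd
  have e1 : 2 * (2 + k) - 2 = 2 * k + 2 := by omega
  have e2 : 3 + d - 2 = d + 1 := by omega
  have e3 : 2 + k - 1 = k + 1 := by omega
  have e4 : 3 + d - 1 = d + 2 := by omega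
  simp only [Fintype.card_sum, Fintype.card_prod, Fintype.card_fin, e1, e2, e3, e4]
  ring

lemma sum_catLevel (hk : 2 ≤ k) (hd : 3 ≤ d) :
    ∑ u : Fin (2 * k) ⊕ Fin (2 * k - 2) × Fin (d - 2), catLevel k u =
      (d - 1) * (k * (k - 1)) := by
  obtain ⟨k, rfl⟩ := Nat.exists_eq_add_of_le' (show 1 ≤ k by omega)
  obtain ⟨d, rfl⟩ := Nat.exists_eq_add_of_le' (show 2 ≤ d by omega)
  have aux : ∀ (j c : ℕ), ∑ i ∈ range (2 * j), ((if i < j then j - 1 - i else i - j) + c) =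
      j * (j - 1) + 2 * j * c := by
    intro j c
    have h1 : ∑ i ∈ range j, ((if i < j then j - 1 - i else i - j) + c) =
        ∑ i ∈ range j, i + j * c := by
      rw [sum_add_distrib, sum_const, card_range, smul_eq_mul, ← sum_range_reflect]
      congr 1
      refine sum_congr rfl fun i hi => ?_
      have := mem_range.mp hi
      split_ifs <;> omega
    have h2 : ∑ i ∈ range j, ((if j + i < j then j - 1 - (j + i) else j + i - j) + c) =
        ∑ i ∈ range j, i + j * c := by
      rw [sum_add_distrib, sum_const, card_range, smul_eq_mul]
      congr 1
      exact sum_congr rfl fun i _ => by split_ifs <;> omega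
    have h3 := sum_range_id_mul_two j
    rw [two_mul, sum_range_add, h1, h2]
    linarith
  have hspine : ∑ i : Fin (2 * (k + 1)), catLevel (m := 2 * (k + 1)) (d := d + 2) (k + 1)
      (Sum.inl i) = (k + 1) * k := by
    have := aux (k + 1) 0
    simp only [mul_zero, add_zero, Nat.add_sub_cancel] at this
    rw [← this, ← Fin.sum_univ_eq_sum_range
      (fun i => if i < k + 1 then k - i else i - (k + 1))]
    rfl
  have hlegs : ∑ p : Fin (2 * (k + 1) - 2) × Fin (d + 2 - 2),
      catLevel (m := 2 * (k + 1)) (d := d + 2) (k + 1) (Sum.inr p) = d * (k * (k + 1)) := by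
    have := aux k 1
    have hcat : ∀ (a : Fin (2 * (k + 1) - 2)) (b : Fin (d + 2 - 2)),
        catLevel (m := 2 * (k + 1)) (d := d + 2) (k + 1) (Sum.inr (a, b)) =
          (if a.val < k then k - 1 - a.val else a.val - k) + 1 := by
      intro a b
      change (if a.val + 1 < k + 1 then k + 1 - 1 - (a.val + 1) else a.val + 1 - (k + 1)) + 1 = _
      split_ifs <;> omega
    simp only [Fintype.sum_prod_type, hcat, sum_const, card_univ, Fintype.card_fin, smul_eq_mul,
      ← mul_sum]
    rw [Fin.sum_univ_eq_sum_range (fun i => (if i < k then k - 1 - i else i - k) + 1)]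
    have e : k * (k + 1) = k * (k - 1) + 2 * k * 1 := by
      rcases k with _ | k
      · rfl
      · simp only [Nat.add_sub_cancel]; ring
    rw [e, ← this]
    rfl
  rw [Fintype.sum_sum_type, hspine, hlegs]
  simp only [Nat.add_sub_cancel, show d + 2 - 1 = d + 1 by omega]
  ring

/-- The value of the span: the lower bound obtained by summing the consecutive gaps. -/
lemma span_value (hk : 2 ≤ k) (hd : 3 ≤ d) {n : ℕ} (hn : n = 2 * ((k - 1) * (d - 1) + 1)) :
    ((2 * (2 * d - 3) * (d - 1) * (k - 1) ^ 2 : ℕ) : ℤ) =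
      (n - 1) * (n - 2) - 2 * ((d - 1) * (k * (k - 1)) : ℕ) := by
  subst hn
  obtain ⟨k, rfl⟩ := Nat.exists_eq_add_of_le' (show 1 ≤ k by omega)
  obtain ⟨d, rfl⟩ := Nat.exists_eq_add_of_le' (show 2 ≤ d by omega)
  have e1 : 2 * (d + 2) - 3 = 2 * d + 1 := by omega
  have e2 : d + 2 - 1 = d + 1 := by omega
  simp only [Nat.add_sub_cancel, e1, e2]
  push_cast
  ring

lemma le_spanOf {V : Type*} [Finite V] (h : V → ℕ) (u v : V) :
    Nat.dist (h u) (h v) ≤ spanOf h :=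
  le_csSup (Set.finite_range _).bddAbove ⟨(u, v), rfl⟩

lemma le_spanOf_of_isHamiltonianColoring (hk : 2 ≤ k) (hd : 3 ≤ d)
    {h : Fin (2 * k) ⊕ Fin (2 * k - 2) × Fin (d - 2) → ℕ}
    (hh : IsHamiltonianColoring (caterpillar (2 * k) d) h) :
    2 * (2 * d - 3) * (d - 1) * (k - 1) ^ 2 ≤ spanOf h := by
  have hcard := card_caterpillar hk hd
  have hspan := span_value hk hd hcard
  have hsum := sum_catLevel hk hd
  obtain ⟨n, hn⟩ : ∃ n, Fintype.card (Fin (2 * k) ⊕ Fin (2 * k - 2) × Fin (d - 2)) = n + 1 :=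
    ⟨2 * ((k - 1) * (d - 1)) + 1, by rw [hcard]; ring⟩
  let e := (Fintype.equivFinOfCardEq hn).symm
  let u := (Tuple.sort (h ∘ e)).trans e
  have hmono : Monotone (h ∘ u) := Tuple.monotone_sort (h ∘ e)
  have hstep : ∀ t (ht : t < n),
      ((h (u ⟨t, by omega⟩) : ℕ) : ℤ) + n - 1 - catLevel k (u ⟨t, by omega⟩)
        - catLevel k (u ⟨t + 1, by omega⟩) ≤ h (u ⟨t + 1, by omega⟩) := by
    intro t ht
    have h1 : h (u ⟨t, by omega⟩) ≤ h (u ⟨t + 1, by omega⟩) :=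
      hmono (show (⟨t, by omega⟩ : Fin (n + 1)) ≤ ⟨t + 1, by omega⟩ from Nat.le_succ t)
    have h2 := hh (u ⟨t, by omega⟩) (u ⟨t + 1, by omega⟩)
      (fun e => by simpa using u.injective e)
    have h3 := catDist_le_catLevel (u ⟨t, by omega⟩) (u ⟨t + 1, by omega⟩)
    rw [detourDist_caterpillar, hn, Nat.dist_eq_sub_of_le h1] at h2
    omega
  have htel : ∀ t (ht : t < n + 1), ((h (u ⟨0, by omega⟩) : ℕ) : ℤ) + t * (n - 1)
      + catLevel k (u ⟨0, by omega⟩) + catLevel k (u ⟨t, ht⟩)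
      - 2 * ∑ s : Fin (t + 1), (catLevel k (u ⟨s, by omega⟩) : ℤ) ≤ h (u ⟨t, ht⟩) := by
    intro t
    induction t with
    | zero => intro _; simp; omega
    | succ t ih =>
      intro ht
      have h1 := ih (by omega)
      have h2 := hstep t (by omega)
      rw [Fin.sum_univ_castSucc]
      simp only [Fin.val_castSucc, Fin.val_last]
      push_cast
      linarith
  have hlast := htel n (by omega)
  have hS : ∑ s : Fin (n + 1), (catLevel k (u ⟨s, by omega⟩) : ℤ) =
      ((d - 1) * (k * (k - 1)) : ℕ) := by
    rw [← hsum, ← Equiv.sum_comp u]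
    push_cast
    rfl
  rw [hS] at hlast
  have hd1 := le_spanOf h (u ⟨0, by omega⟩) (u ⟨n, by omega⟩)
  unfold Nat.dist at hd1
  rw [hn] at hspan
  have : ((n + 1 : ℕ) - 1 : ℤ) * ((n + 1 : ℕ) - 2) = n * (n - 1) := by push_cast; ring
  rw [this] at hspan
  omega

/-- The reflection of the caterpillar that exchanges the two halves of the spine. -/
def catMirror (m d : ℕ) (u : Fin m ⊕ Fin (m - 2) × Fin (d - 2)) :
    Fin m ⊕ Fin (m - 2) × Fin (d - 2) :=
  Sum.map Fin.rev (Prod.map Fin.rev id) u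

lemma catMirror_catMirror {m : ℕ} (u : Fin m ⊕ Fin (m - 2) × Fin (d - 2)) :
    catMirror m d (catMirror m d u) = u := by
  rcases u with i | ⟨a, b⟩ <;> simp [catMirror]

lemma spinePos_catMirror {m : ℕ} (u : Fin m ⊕ Fin (m - 2) × Fin (d - 2)) :
    spinePos (catMirror m d u) = m - 1 - spinePos u := by
  rcases u with i | ⟨a, b⟩ <;> simp [catMirror, spinePos, Fin.val_rev] <;> omega

lemma legHeight_catMirror {m : ℕ} (u : Fin m ⊕ Fin (m - 2) × Fin (d - 2)) :
    legHeight (catMirror m d u) = legHeight u := by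
  rcases u with i | ⟨a, b⟩ <;> rfl

lemma card_left_half (hk : 2 ≤ k) (hd : 3 ≤ d) :
    Fintype.card {u : Fin (2 * k) ⊕ Fin (2 * k - 2) × Fin (d - 2) // spinePos u < k} =
      (k - 1) * (d - 1) + 1 := by
  have hcard := card_caterpillar hk hd
  have e : {u : Fin (2 * k) ⊕ Fin (2 * k - 2) × Fin (d - 2) // spinePos u < k} ≃
      {u : Fin (2 * k) ⊕ Fin (2 * k - 2) × Fin (d - 2) // ¬ spinePos u < k} :=
    { toFun := fun u => ⟨catMirror _ _ u.1, by
        have := u.2; rw [spinePos_catMirror]; omega⟩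
      invFun := fun u => ⟨catMirror _ _ u.1, by
        have := u.2; have := spinePos_lt u.1; rw [spinePos_catMirror]; omega⟩
      left_inv := fun u => Subtype.ext (catMirror_catMirror _)
      right_inv := fun u => Subtype.ext (catMirror_catMirror _) }
  have h1 := Fintype.card_congr e
  have h2 := Fintype.card_congr (Equiv.sumCompl
    (fun u : Fin (2 * k) ⊕ Fin (2 * k - 2) × Fin (d - 2) => spinePos u < k))
  rw [Fintype.card_sum] at h2
  omega

/-- An ordering of the vertices alternating between the two halves, from one center to the
other. -/
lemma exists_alternating_ordering (hk : 2 ≤ k) (hd : 3 ≤ d) {n : ℕ}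
    (hn : n + 1 = 2 * ((k - 1) * (d - 1) + 1)) :
    ∃ u : ℕ → Fin (2 * k) ⊕ Fin (2 * k - 2) × Fin (d - 2),
      (∀ v, ∃ t ≤ n, u t = v) ∧ (∀ t, spinePos (u t) < k ↔ ¬ spinePos (u (t + 1)) < k) ∧
      catLevel k (u 0) = 0 ∧ catLevel k (u n) = 0 := by
  set N := (k - 1) * (d - 1) with hN
  let e := Fintype.equivFinOfCardEq (card_left_half hk hd)
  let c : {u : Fin (2 * k) ⊕ Fin (2 * k - 2) × Fin (d - 2) // spinePos u < k} :=
    ⟨Sum.inl ⟨k - 1, by omega⟩, by simp only [spinePos]; omega⟩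
  let f := e.symm.trans (Equiv.swap (e.symm 0) c)
  have hf0 : f 0 = c := by simp [f]
  have hc : spinePos (d := d) c.1 = k - 1 := rfl
  have hcl : legHeight (d := d) c.1 = 0 := rfl
  let u : ℕ → Fin (2 * k) ⊕ Fin (2 * k - 2) × Fin (d - 2) := fun t =>
    if t % 2 = 0 then (f (Fin.ofNat (N + 1) (t / 2))).1
    else catMirror _ _ (f (Fin.ofNat (N + 1) (N - t / 2))).1
  have hside : ∀ t, spinePos (u t) < k ↔ t % 2 = 0 := by
    intro t
    by_cases ht : t % 2 = 0
    · simp only [u, ht, if_true, iff_true]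
      exact (f _).2
    · simp only [u, ht, if_false, iff_false, spinePos_catMirror]
      have := (f (Fin.ofNat (N + 1) (N - t / 2))).2
      omega
  refine ⟨u, fun v => ?_, fun t => ?_, ?_, ?_⟩
  · by_cases hv : spinePos v < k
    · obtain ⟨i, hi⟩ := f.surjective ⟨v, hv⟩
      refine ⟨2 * i.val, by omega, ?_⟩
      have : Fin.ofNat (N + 1) (2 * i.val / 2) = i := by
        ext; simp
      simp only [u, Nat.mul_mod_right, if_true, this, hi]
    · have hv' : spinePos (catMirror _ _ v) < k := by
        have := spinePos_lt v
        rw [spinePos_catMirror]; omega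
      obtain ⟨i, hi⟩ := f.surjective ⟨_, hv'⟩
      refine ⟨2 * (N - i.val) + 1, by omega, ?_⟩
      have : Fin.ofNat (N + 1) (N - (2 * (N - i.val) + 1) / 2) = i := by
        have h1 : N - (2 * (N - i.val) + 1) / 2 = i.val := by omega
        ext; simp [h1]
      have h2 : ¬ (2 * (N - i.val) + 1) % 2 = 0 := by omega
      simp only [u, h2, if_false, this, hi, catMirror_catMirror]
  · rw [hside, hside]
    omega
  · have : u 0 = c.1 := by
      have h0 : Fin.ofNat (N + 1) (0 / 2) = 0 := rfl
      simp only [u, Nat.zero_mod, if_true, h0, hf0]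
    rw [this, catLevel, hc, hcl]
    split_ifs <;> omega
  · have : u n = catMirror _ _ c.1 := by
      have h1 : N - n / 2 = 0 := by omega
      have h2 : ¬ n % 2 = 0 := by omega
      have h0 : Fin.ofNat (N + 1) 0 = 0 := rfl
      simp only [u, h2, if_false, h1, h0, hf0]
    rw [this, catLevel, spinePos_catMirror, legHeight_catMirror, hc, hcl]
    split_ifs <;> omega

lemma exists_isHamiltonianColoring_spanOf_le (hk : 2 ≤ k) (hd : 3 ≤ d) :
    ∃ h : Fin (2 * k) ⊕ Fin (2 * k - 2) × Fin (d - 2) → ℕ,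
      IsHamiltonianColoring (caterpillar (2 * k) d) h ∧
        spanOf h ≤ 2 * (2 * d - 3) * (d - 1) * (k - 1) ^ 2 := by
  have hcard := card_caterpillar hk hd
  have hspan := span_value hk hd hcard
  have hsum := sum_catLevel hk hd
  obtain ⟨n, hn⟩ : ∃ n, Fintype.card (Fin (2 * k) ⊕ Fin (2 * k - 2) × Fin (d - 2)) = n + 1 :=
    ⟨2 * ((k - 1) * (d - 1)) + 1, by rw [hcard]; ring⟩
  have hnk : 4 * k - 3 ≤ n := by
    have : (k - 1) * 2 ≤ (k - 1) * (d - 1) := Nat.mul_le_mul_left _ (by omega)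
    omega
  obtain ⟨u, hu, hside, hu0, hun⟩ := exists_alternating_ordering hk hd (hn.symm.trans hcard)
  have hdist := fun t => catDist_of_opposite (u t) (u (t + 1)) (hside t)
  have hlev := fun t => catLevel_le hk (u t)
  let H : ℕ → ℕ := fun t => ∑ s ∈ range t, (n - catDist (u s) (u (s + 1)))
  have hH0 : H 0 = 0 := rfl
  have hHs : ∀ t, H (t + 1) + catLevel k (u t) + catLevel k (u (t + 1)) + 1 = H t + n := by
    intro t
    have h1 : H (t + 1) = H t + (n - catDist (u t) (u (t + 1))) := sum_range_succ _ _
    have := hdist t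
    have := hlev t
    have := hlev (t + 1)
    omega
  have hmono : Monotone H := monotone_nat_of_le_succ fun t => by
    have := hHs t
    have := hlev t
    have := hlev (t + 1)
    omega
  choose idx hidx hidxu using hu
  have hlt : ∀ a b, a ≠ b → idx a < idx b → n ≤ catDist a b + (H (idx b) - H (idx a)) := by
    intro a b hab hlt
    obtain ⟨i, hi⟩ : ∃ i, idx a = i := ⟨_, rfl⟩
    obtain ⟨j, hj⟩ : ∃ j, idx b = j := ⟨_, rfl⟩
    have ha := hidxu a
    have hb := hidxu b
    rw [hi] at ha hlt ⊢
    rw [hj] at hb hlt ⊢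
    have g1 := hHs i
    have g2 := hHs (i + 1)
    have g3 := hHs (i + 2)
    have l0 := hlev i
    have l1 := hlev (i + 1)
    have l2 := hlev (i + 2)
    have l3 := hlev (i + 3)
    simp only [add_assoc, Nat.reduceAdd] at g1 g2 g3
    rcases (by omega : j = i + 1 ∨ j = i + 2 ∨ i + 3 ≤ j) with h | h | h
    · have := hdist i
      rw [h] at hb ⊢
      rw [ha, hb] at this g1
      omega
    · have := catLevel_add_le_of_ne hk hab
      rw [h] at hb ⊢
      rw [ha] at g1
      rw [hb] at g2
      omega
    · have := hmono h
      omega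
  refine ⟨fun v => H (idx v), fun a b hab => ?_, ?_⟩
  · rw [detourDist_caterpillar, hn, Nat.add_sub_cancel]
    change n ≤ catDist a b + Nat.dist (H (idx a)) (H (idx b))
    have hne : idx a ≠ idx b := fun e => hab (by rw [← hidxu a, ← hidxu b, e])
    unfold Nat.dist
    rcases lt_or_gt_of_ne hne with h | h
    · have := hlt a b hab h
      omega
    · have := hlt b a hab.symm h
      rw [catDist_comm] at this
      omega
  · have htel : ∀ t, (H t : ℤ) + 2 * ∑ s ∈ range (t + 1), (catLevel k (u s) : ℤ) =
        t * (n - 1) + catLevel k (u 0) + catLevel k (u t) := by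
      intro t
      induction t with
      | zero => simp [hH0]; omega
      | succ t ih =>
        rw [sum_range_succ]
        have := hHs t
        push_cast
        zify at this
        linarith
    have hbij : Function.Bijective (fun t : Fin (n + 1) => u t) := by
      rw [Fintype.bijective_iff_surjective_and_card]
      refine ⟨fun v => ⟨⟨idx v, by have := hidx v; omega⟩, hidxu v⟩, ?_⟩
      rw [Fintype.card_fin, hn]
    have hS : ∑ s ∈ range (n + 1), (catLevel k (u s) : ℤ) = ((d - 1) * (k * (k - 1)) : ℕ) := by
      rw [← hsum, ← hbij.sum_comp, Fin.sum_univ_eq_sum_range (fun s => catLevel k (u s))]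
      push_cast
      rfl
    have hHn := htel n
    rw [hS, hu0, hun] at hHn
    rw [hn] at hspan
    have e1 : ((n + 1 : ℕ) - 1 : ℤ) * ((n + 1 : ℕ) - 2) = n * (n - 1) := by push_cast; ring
    rw [e1] at hspan
    have : Nonempty (Fin (2 * k)) := ⟨⟨0, by omega⟩⟩
    refine csSup_le (Set.range_nonempty _) ?_
    simp only [Set.mem_range, forall_exists_index]
    rintro _ ⟨a, b⟩ rfl
    have h1 := hmono (hidx a)
    have h2 := hmono (hidx b)
    simp only [Nat.dist]
    omega

lemma hc_caterpillar_even (hk : 2 ≤ k) (hd : 3 ≤ d) :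
    hc (caterpillar (2 * k) d) = 2 * (2 * d - 3) * (d - 1) * (k - 1) ^ 2 := by
  obtain ⟨h, hh, hle⟩ := exists_isHamiltonianColoring_spanOf_le hk hd
  have hmem : spanOf h ∈ {s | ∃ h, IsHamiltonianColoring (caterpillar (2 * k) d) h ∧
      spanOf h = s} := ⟨h, hh, rfl⟩
  refine le_antisymm ((Nat.sInf_le hmem).trans hle) ?_
  refine le_csInf ⟨_, hmem⟩ ?_
  rintro s ⟨g, hg, rfl⟩
  exact le_spanOf_of_isHamiltonianColoring hk hd hg

end EvenSpine


/-- For even `m = 2k ≥ 4` and `d ≥ 3`, the caterpillar `C(m,d)` of order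
`n = (2k-2)(d-1) + 2` has `hc(C(m,d)) = ((2d-3)/(2d-2))(n-2)²`, i.e.
`2(d-1)·hc = (2d-3)(n-2)²`, equivalently `hc = 2(2d-3)(d-1)(k-1)²`. -/
theorem stmt19 (k d : ℕ) (hk : 2 ≤ k) (hd : 3 ≤ d) :
    Fintype.card (Fin (2 * k) ⊕ Fin (2 * k - 2) × Fin (d - 2)) =
      (2 * k - 2) * (d - 1) + 2 ∧
    2 * (d - 1) * hc (caterpillar (2 * k) d) =
      (2 * d - 3) * ((2 * k - 2) * (d - 1)) ^ 2 ∧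
    hc (caterpillar (2 * k) d) = 2 * (2 * d - 3) * (d - 1) * (k - 1) ^ 2 := by
  have e : 2 * k - 2 = 2 * (k - 1) := by omega
  refine ⟨?_, ?_, hc_caterpillar_even hk hd⟩
  · rw [card_caterpillar hk hd, e]
    ring
  · rw [hc_caterpillar_even hk hd, e]
    ring

end HCPaper
end
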